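/- arXiv:math/9902139 — 2 statements merged into one kernel-verified Lean document; each statement's English description precedes it below -/
import Mathlib

section
/- Let m,n ≥ 1 and let x, y_1,…,y_{N−1} be nonzero complex numbers; set y_0 = y_N = 1 and d_α = y_α/y_{α+1} for 0 ≤ α ≤ N−1. Suppose that for all admissible nonzero arguments g satisfies: (b) for each 1 ≤ i ≤ n−1 and lower indices at positions i, i+1: if α ≠ β then g(ζ|…,ξ_{i+1},ξ_i,…)^{ε}_{…,α,β,…} = b(ξ_i/ξ_{i+1}) g(ζ|…,ξ_i,ξ_{i+1},…)^{ε}_{…,β,α,…} + c_{βα}(ξ_i/ξ_{i+1}) g(ζ|…,ξ_i,ξ_{i+1},…)^{ε}_{…,α,β,…}, and g(ζ|…,ξ_{i+1},ξ_i,…)^{ε}_{…,α,α,…} = g(ζ|…,ξ_i,ξ_{i+1},…)^{ε}_{…,α,α,…}; (d) g(ζ|xξ_1,ξ_2,…,ξ_n)^{ε}_{μ_1,…,μ_n} = g(ζ|ξ_2,…,ξ_n,ξ_1)^{ε}_{μ_2,…,μ_n,μ_1} · d_{μ_1}. Then for every 1 ≤ i ≤ n, viewing g(ζ|ξ)^{ε}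 as the linear functional on (ℂ^N)^{⊗n} sending v_{μ_1}⊗⋯⊗v_{μ_n} to g(ζ|ξ)^{ε}_{μ}, one has g(ζ|ξ_1,…,xξ_i,…,ξ_n)^{ε} = g(ζ|ξ_1,…,ξ_n)^{ε} ∘ K_i^{(2)}, where K_i^{(2)} = R̄_{i,i+1}(ξ_i/ξ_{i+1}) ⋯ R̄_{i,n}(ξ_i/ξ_n) · (y^{−H})_i · R̄_{i,1}(xξ_i/ξ_1) ⋯ R̄_{i,i−1}(xξ_i/ξ_{i−1}) as an operator on (ℂ^N)^{⊗n}, with R̄_{a,b}(ζ) acting as R̄(ζ) on the a-th and b-th tensor factors (first slot of R̄ on factor a) and (y^{−H})_i the diagonal operator multiplying v_α in the i-th factor by d_α. -/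
open scoped BigOperators

/-- `b(ζ) = q(1-ζ^N)/(1-q²ζ^N)`. -/
noncomputable def bFun (N : ℕ) (q ζ : ℂ) : ℂ := q * (1 - ζ ^ N) / (1 - q ^ 2 * ζ ^ N)

/-- `c_{jk}(ζ) = (1-q²) ζ^{Nθ(k-j)+j-k}/(1-q²ζ^N)` where `θ(s)=1` iff `s ≥ 0`. -/
noncomputable def cFun (N : ℕ) (q : ℂ) (j k : Fin N) (ζ : ℂ) : ℂ :=
  (1 - q ^ 2) * ζ ^ ((N : ℤ) * (if j ≤ k then 1 else 0) + (j : ℤ) - (k : ℤ))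
    / (1 - q ^ 2 * ζ ^ N)

/-- Components `R̄(ζ)^{ij}_{i'j'}` of the R-matrix, defined by
`R̄(ζ)(v_j ⊗ v_j) = v_j ⊗ v_j` and
`R̄(ζ)(v_j ⊗ v_k) = b(ζ) v_j ⊗ v_k + c_{jk}(ζ) v_k ⊗ v_j` for `j ≠ k`. -/
noncomputable def Rc (N : ℕ) (q ζ : ℂ) (i j i' j' : Fin N) : ℂ :=
  if i = j then (if i' = i ∧ j' = j then 1 else 0)
  else if i' = i ∧ j' = j then bFun N q ζ
  else if i' = j ∧ j' = i then cFun N q i j ζ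
  else 0

/-- The operator `R̄_{a,b}(ζ)` acting on `(ℂ^N)^{⊗m}`, identified with its space of
coordinate functions `(Fin m → Fin N) → ℂ`; the first slot of `R̄` acts on factor `a`,
the second on factor `b`. -/
noncomputable def Rop (N : ℕ) (q : ℂ) {m : ℕ} (a b : Fin m) (ζarg : ℂ)
    (v : (Fin m → Fin N) → ℂ) : (Fin m → Fin N) → ℂ :=
  fun ε => ∑ i : Fin N, ∑ j : Fin N,
    Rc N q ζarg i j (ε a) (ε b) * v (Function.update (Function.update ε a i) b j)

/-- The diagonal operator multiplying `v_α` in the `i`-th tensor factor by `d α`. -/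
noncomputable def Dop (N : ℕ) {m : ℕ} (i : Fin m) (d : Fin N → ℂ)
    (v : (Fin m → Fin N) → ℂ) : (Fin m → Fin N) → ℂ :=
  fun ε => d (ε i) * v ε

/-- Composition of a list of operators: the leftmost operator in the list is applied last,
matching the left-to-right order of an operator product. -/
def composeList {α : Type*} (ops : List (α → α)) : α → α := ops.foldr (· ∘ ·) id

/-- `⟨j % m, _⟩ : Fin m`. -/
def mkFin (m : ℕ) (hm : 0 < m) (j : ℕ) : Fin m := ⟨j % m, Nat.mod_lt _ hm⟩

theorem Rop_apply (N : ℕ) (q : ℂ) {n : ℕ} {a b : Fin n} (hab : a ≠ b) (z : ℂ)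
    (v : (Fin n → Fin N) → ℂ) (ε : Fin n → Fin N) :
    Rop N q a b z v ε = if ε a = ε b then v ε else
      bFun N q z * v ε + cFun N q (ε b) (ε a) z * v (ε ∘ Equiv.swap a b) := by
  have hR : ∀ i j i' j' : Fin N, Rc N q z i j i' j' =
      (if i = i' then if j = j' then if i' = j' then 1 else bFun N q z else 0 else 0) +
      (if i = j' then if j = i' then if i' = j' then 0 else cFun N q j' i' z else 0 else 0) := by
    intro i j i' j'
    unfold Rc
    grind
  have h1 : Function.update (Function.update ε a (ε a)) b (ε b) = ε := by simp
  have h2 : Function.update (Function.update ε a (ε b)) b (ε a) = ε ∘ Equiv.swap a b := by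
    funext t
    simp only [Function.update_apply, Function.comp_apply, Equiv.swap_apply_def]
    grind
  simp only [Rop, hR, add_mul, ite_mul, zero_mul, one_mul, Finset.sum_add_distrib,
    Finset.sum_ite_irrel, Finset.sum_const_zero, Finset.sum_ite_eq', Finset.mem_univ, if_true,
    h1, h2]
  split_ifs <;> simp

/-- The transpose of `Rop`, acting on linear functionals through their coordinates. -/
noncomputable def RopT (N : ℕ) (q : ℂ) {n : ℕ} (a b : Fin n) (z : ℂ)
    (F : (Fin n → Fin N) → ℂ) : (Fin n → Fin N) → ℂ :=
  fun μ => if μ a = μ b then F μ else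
    bFun N q z * F μ + cFun N q (μ a) (μ b) z * F (μ ∘ Equiv.swap a b)

/-- `T` is the transpose of `A` for the coordinatewise pairing. -/
def IsTranspose {κ : Type*} [Fintype κ] (A T : (κ → ℂ) → κ → ℂ) : Prop :=
  ∀ v F : κ → ℂ, ∑ k, A v k * F k = ∑ k, v k * T F k

theorem IsTranspose.comp {κ : Type*} [Fintype κ] {A T B S : (κ → ℂ) → κ → ℂ}
    (hA : IsTranspose A T) (hB : IsTranspose B S) : IsTranspose (A ∘ B) (S ∘ T) :=
  fun v F => (hA (B v) F).trans (hB v (T F))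

theorem composeList_append {α : Type*} (l₁ l₂ : List (α → α)) :
    composeList (l₁ ++ l₂) = composeList l₁ ∘ composeList l₂ := by
  induction l₁ with
  | nil => rfl
  | cons f l ih =>
    change f ∘ composeList (l ++ l₂) = _
    rw [ih]
    rfl

theorem isTranspose_composeList_map {κ ι : Type*} [Fintype κ] (A T : ι → (κ → ℂ) → κ → ℂ)
    (l : List ι) (h : ∀ t ∈ l, IsTranspose (A t) (T t)) :
    IsTranspose (composeList (l.map A)) (l.foldl fun F t => T t F) := by
  induction l with
  | nil => exact fun _ _ => rfl
  | cons t l ih =>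
    exact (h t (by simp)).comp (ih fun s hs => h s (by simp [hs]))

theorem isTranspose_Rop (N : ℕ) (q : ℂ) {n : ℕ} {a b : Fin n} (hab : a ≠ b) (z : ℂ) :
    IsTranspose (Rop N q a b z) (RopT N q a b z) := by
  intro v F
  have hsw : ∀ f : (Fin n → Fin N) → ℂ,
      ∑ μ, f (μ ∘ Equiv.swap a b) = ∑ μ, f μ := fun f =>
    Equiv.sum_comp ((Equiv.swap a b).symm.arrowCongr (Equiv.refl (Fin N))) f
  have hinv : ∀ μ : Fin n → Fin N, (μ ∘ Equiv.swap a b) ∘ Equiv.swap a b = μ := fun μ => by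
    funext t
    simp
  have hl : ∀ μ, Rop N q a b z v μ * F μ =
      (if μ a = μ b then v μ * F μ else bFun N q z * v μ * F μ) +
      (if μ a = μ b then 0 else
        cFun N q (μ b) (μ a) z * v (μ ∘ Equiv.swap a b) * F μ) := by
    intro μ
    rw [Rop_apply N q hab]
    split_ifs <;> ring
  have hr : ∀ μ, v μ * RopT N q a b z F μ =
      (if μ a = μ b then v μ * F μ else bFun N q z * v μ * F μ) +
      (if μ a = μ b then 0 else
        cFun N q (μ a) (μ b) z * v μ * F (μ ∘ Equiv.swap a b)) := by
    intro μ
    unfold RopT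
    split_ifs <;> ring
  simp only [hl, hr, Finset.sum_add_distrib]
  congr 1
  rw [← hsw fun μ => if μ a = μ b then 0 else
    cFun N q (μ a) (μ b) z * v μ * F (μ ∘ Equiv.swap a b)]
  simp only [hinv, Function.comp_apply, Equiv.swap_apply_left, Equiv.swap_apply_right, eq_comm]

theorem isTranspose_Dop (N : ℕ) {n : ℕ} (i : Fin n) (d : Fin N → ℂ) :
    IsTranspose (Dop N i d) (Dop N i d) := by
  intro v F
  refine Finset.sum_congr rfl fun μ _ => ?_
  unfold Dop
  ring

theorem IsTranspose.sum_single {κ : Type*} [Fintype κ] [DecidableEq κ]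
    {A T : (κ → ℂ) → κ → ℂ} (h : IsTranspose A T) (F : κ → ℂ) (k : κ) :
    ∑ l, A (fun ν => if ν = k then 1 else 0) l * F l = T F k := by
  rw [h]
  simp

theorem mkFin_eq {n : ℕ} (hn : 0 < n) {k : ℕ} (hk : k < n) : mkFin n hn k = ⟨k, hk⟩ :=
  Fin.ext (Nat.mod_eq_of_lt hk)

/-- The exchange relation `f (s_i ξ) = f ξ ∘ R̄_{i,i+1}(ξ_i/ξ_{i+1}) P_{i,i+1}`
in components. -/
def IsExchange (N : ℕ) (q : ℂ) {n : ℕ} (f : (Fin n → ℂ) → (Fin n → Fin N) → ℂ) : Prop :=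
  ∀ ξ : Fin n → ℂ, (∀ t, ξ t ≠ 0) → ∀ (i j : Fin n), (j : ℕ) = i + 1 →
    ∀ μ : Fin n → Fin N, f (ξ ∘ Equiv.swap i j) (μ ∘ Equiv.swap i j) =
      RopT N q i j (ξ i / ξ j) (f ξ) μ

theorem IsExchange.perm_mul_swap {N : ℕ} {q : ℂ} {n : ℕ}
    {f : (Fin n → ℂ) → (Fin n → Fin N) → ℂ} (hf : IsExchange N q f)
    {ξ : Fin n → ℂ} (hξ : ∀ t, ξ t ≠ 0) (σ : Equiv.Perm (Fin n)) {i j : Fin n}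
    (hij : (j : ℕ) = i + 1) :
    (fun μ : Fin n → Fin N => f (ξ ∘ ⇑(σ * Equiv.swap i j)) (μ ∘ ⇑(σ * Equiv.swap i j))) =
      RopT N q (σ i) (σ j) (ξ (σ i) / ξ (σ j)) fun μ => f (ξ ∘ σ) (μ ∘ σ) := by
  funext μ
  have h := hf (ξ ∘ σ) (fun t => hξ _) i j hij (μ ∘ σ)
  have hs : (μ ∘ σ) ∘ Equiv.swap i j = (μ ∘ Equiv.swap (σ i) (σ j)) ∘ σ := by
    funext t
    simp only [Function.comp_apply, Equiv.swap_apply_def, σ.injective.eq_iff]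
    split_ifs <;> rfl
  simp only [RopT, hs] at h
  rw [← hs] at h
  simpa only [RopT, Function.comp_apply, Equiv.Perm.coe_mul, ← hs, Function.comp_assoc] using h

/-- Transporting the entry at position `p` rightwards through `t` neighbours. -/
theorem IsExchange.exists_move {N : ℕ} {q : ℂ} {n : ℕ} (hn : 0 < n)
    {f : (Fin n → ℂ) → (Fin n → Fin N) → ℂ} (hf : IsExchange N q f)
    {ξ : Fin n → ℂ} (hξ : ∀ t, ξ t ≠ 0) (σ : Equiv.Perm (Fin n)) (p : Fin n) (t : ℕ)
    (ht : (p : ℕ) + t < n) :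
    ∃ σ' : Equiv.Perm (Fin n),
      (∀ k : Fin n, (k : ℕ) = p + t → σ' k = σ p) ∧
      (∀ k l : Fin n, p ≤ k → (k : ℕ) < p + t → (l : ℕ) = k + 1 → σ' k = σ l) ∧
      (∀ k : Fin n, k < p ∨ (p : ℕ) + t < k → σ' k = σ k) ∧
      (fun μ : Fin n → Fin N => f (ξ ∘ σ') (μ ∘ σ')) =
        (List.range t).foldl (fun F s => RopT N q (σ p) (σ (mkFin n hn (p + 1 + s)))
          (ξ (σ p) / ξ (σ (mkFin n hn (p + 1 + s)))) F) (fun μ => f (ξ ∘ σ) (μ ∘ σ)) := by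
  induction t with
  | zero =>
    refine ⟨σ, fun k hk => congrArg σ (Fin.ext hk), fun k l h1 h2 => ?_, fun _ _ => rfl, rfl⟩
    rw [Fin.le_def] at h1
    omega
  | succ t ih =>
    obtain ⟨σ', h1, h2, h3, h4⟩ := ih (by omega)
    have ha : (p : ℕ) + t < n := by omega
    have hb : (p : ℕ) + 1 + t < n := by omega
    refine ⟨σ' * Equiv.swap ⟨p + t, ha⟩ ⟨p + 1 + t, hb⟩, fun k hk => ?_,
      fun k l hk1 hk2 hl => ?_, fun k hk => ?_, ?_⟩
    · have : k = ⟨p + 1 + t, hb⟩ := Fin.ext (by simp only; omega)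
      rw [this, Equiv.Perm.mul_apply, Equiv.swap_apply_right, h1 _ rfl]
    · rw [Equiv.Perm.mul_apply]
      by_cases h : (k : ℕ) = p + t
      · have hk : k = ⟨p + t, ha⟩ := Fin.ext h
        have hl' : l = ⟨p + 1 + t, hb⟩ := Fin.ext (by simp only; omega)
        rw [hk, Equiv.swap_apply_left, hl']
        exact h3 _ (Or.inr (by simp only; omega))
      · rw [Equiv.swap_apply_of_ne_of_ne (by simpa [Fin.ext_iff] using h)
          (by simp only [ne_eq, Fin.ext_iff]; omega)]
        exact h2 k l hk1 (by omega) hl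
    · rw [Fin.lt_def] at hk
      rw [Equiv.Perm.mul_apply, Equiv.swap_apply_of_ne_of_ne
        (by simp only [ne_eq, Fin.ext_iff]; omega) (by simp only [ne_eq, Fin.ext_iff]; omega)]
      exact h3 k (by rw [Fin.lt_def]; omega)
    · rw [List.range_succ, List.foldl_append, ← h4, hf.perm_mul_swap hξ σ' (by simp only; omega),
        h1 _ rfl, h3 ⟨p + 1 + t, hb⟩ (Or.inr (by simp only; omega))]
      simp only [List.foldl_cons, List.foldl_nil, mkFin_eq hn hb]

/-- if `g` satisfies the exchange relation (b) and the cyclic shift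
relation (d), then, viewing `g(ζ|ξ)^ε` as a linear functional on `(ℂ^N)^{⊗n}`,
`g(ζ|…,xξ_i,…)^ε = g(ζ|ξ)^ε ∘ K_i^{(2)}` where
`K_i^{(2)} = R̄_{i,i+1}(ξ_i/ξ_{i+1})⋯R̄_{i,n}(ξ_i/ξ_n)(y^{-H})_i
R̄_{i,1}(xξ_i/ξ_1)⋯R̄_{i,i-1}(xξ_i/ξ_{i-1})`. -/
theorem qKZ_lower (N : ℕ) (hN : 2 ≤ N) (q : ℂ) (hq : q ≠ 0)
    (m n : ℕ) (hm : 0 < m) (hn : 0 < n)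
    (x : ℂ) (hx : x ≠ 0)
    (y : ℕ → ℂ) (hy0 : y 0 = 1) (hyN : y N = 1)
    (hy : ∀ r, 1 ≤ r → r ≤ N - 1 → y r ≠ 0)
    (g : (Fin m → ℂ) → (Fin n → ℂ) → (Fin m → Fin N) → (Fin n → Fin N) → ℂ)
    (hb : ∀ (ζ : Fin m → ℂ) (ξ : Fin n → ℂ), (∀ t, ζ t ≠ 0) → (∀ t, ξ t ≠ 0) →
      ∀ (i : Fin n) (hi : (i : ℕ) + 1 < n) (ε : Fin m → Fin N) (μ : Fin n → Fin N)
        (α β : Fin N),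
        (α ≠ β →
          g ζ (fun t => ξ (Equiv.swap i ⟨(i : ℕ) + 1, hi⟩ t)) ε
              (Function.update (Function.update μ i α) ⟨(i : ℕ) + 1, hi⟩ β)
            = bFun N q (ξ i / ξ ⟨(i : ℕ) + 1, hi⟩)
                * g ζ ξ ε (Function.update (Function.update μ i β) ⟨(i : ℕ) + 1, hi⟩ α)
              + cFun N q β α (ξ i / ξ ⟨(i : ℕ) + 1, hi⟩)
                * g ζ ξ ε (Function.update (Function.update μ i α) ⟨(i : ℕ) + 1, hi⟩ β))
        ∧ g ζ (fun t => ξ (Equiv.swap i ⟨(i : ℕ) + 1, hi⟩ t)) ε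
              (Function.update (Function.update μ i α) ⟨(i : ℕ) + 1, hi⟩ α)
            = g ζ ξ ε (Function.update (Function.update μ i α) ⟨(i : ℕ) + 1, hi⟩ α))
    (hd : ∀ (ζ : Fin m → ℂ) (ξ : Fin n → ℂ), (∀ t, ζ t ≠ 0) → (∀ t, ξ t ≠ 0) →
      ∀ (ε : Fin m → Fin N) (μ : Fin n → Fin N),
        g ζ (Function.update ξ ⟨0, hn⟩ (x * ξ ⟨0, hn⟩)) ε μ
          = g ζ (fun t => ξ (mkFin n hn ((t : ℕ) + 1))) ε
                (fun t => μ (mkFin n hn ((t : ℕ) + 1)))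
            * (y (μ ⟨0, hn⟩ : ℕ) / y ((μ ⟨0, hn⟩ : ℕ) + 1))) :
    ∀ (ζ : Fin m → ℂ) (ξ : Fin n → ℂ), (∀ t, ζ t ≠ 0) → (∀ t, ξ t ≠ 0) →
      ∀ (i : Fin n) (ε : Fin m → Fin N) (μ : Fin n → Fin N),
        g ζ (Function.update ξ i (x * ξ i)) ε μ
          = ∑ μ' : Fin n → Fin N,
              (composeList
                (((List.range (n - 1 - (i : ℕ))).map fun t =>
                    Rop N q i (mkFin n hn ((i : ℕ) + 1 + t))
                      (ξ i / ξ (mkFin n hn ((i : ℕ) + 1 + t))))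
                  ++ [Dop N i (fun α : Fin N => y (α : ℕ) / y ((α : ℕ) + 1))]
                  ++ ((List.range (i : ℕ)).map fun t =>
                    Rop N q i (mkFin n hn t) (x * ξ i / ξ (mkFin n hn t))))
                (fun ν : Fin n → Fin N => if ν = μ then (1 : ℂ) else 0)) μ'
              * g ζ ξ ε μ' := by
  intro ζ ξ hζ hξ i ε μ
  have hf : IsExchange N q (fun ξ => g ζ ξ ε) := by
    intro ξ hξ i j hij μ
    have hi : (i : ℕ) + 1 < n := hij ▸ j.2
    obtain rfl : j = ⟨(i : ℕ) + 1, hi⟩ := Fin.ext hij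
    generalize hj : (⟨(i : ℕ) + 1, hi⟩ : Fin n) = j at *
    have hne : i ≠ j := by
      rintro rfl
      omega
    obtain ⟨h1, h2⟩ := hb ζ ξ hζ hξ i hi ε μ (μ j) (μ i)
    have hs : Function.update (Function.update μ i (μ j)) j (μ i) = μ ∘ Equiv.swap i j := by
      funext t
      simp only [Function.update_apply, Function.comp_apply, Equiv.swap_apply_def]
      grind
    simp only [hj, hs, Function.update_eq_self] at h1 h2
    by_cases h : μ i = μ j
    · have hs' : μ ∘ Equiv.swap i j = μ := by
        rw [← hs, h, ← h, Function.update_eq_self, h, Function.update_eq_self]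
      rw [← h, Function.update_eq_self, h, Function.update_eq_self] at h2
      simpa only [RopT, if_pos h, hs'] using! h2
    · simpa only [RopT, if_neg h] using! h1 (Ne.symm h)
  obtain ⟨r, hr⟩ : ∃ r : Equiv.Perm (Fin n), ∀ t, r t = mkFin n hn (t + 1) := by
    obtain ⟨k, rfl⟩ := Nat.exists_eq_succ_of_ne_zero hn.ne'
    refine ⟨finRotate (k + 1), fun t => Fin.ext ?_⟩
    simp [mkFin, Fin.val_add]
  have hin := i.2
  set ξ' : Fin n → ℂ := Function.update ξ i (x * ξ i) with hξ'_def
  have hξ' : ∀ t, ξ' t ≠ 0 := by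
    intro t
    rw [hξ'_def, Function.update_apply]
    split_ifs
    exacts [mul_ne_zero hx (hξ i), hξ t]
  obtain ⟨σ, hσ_last, hσ_mid, hσ_low, hσ⟩ :=
    hf.exists_move hn hξ 1 i (n - 1 - i) (by omega)
  set τ : Equiv.Perm (Fin n) := σ * r⁻¹ with hτ_def
  have hτr : ∀ k, τ (r k) = σ k := fun k => by simp [hτ_def]
  have hτ_succ : ∀ k (hk : k + 1 < n), τ ⟨k + 1, hk⟩ = σ ⟨k, by omega⟩ := by
    intro k hk
    rw [← hτr, hr, mkFin_eq hn (by simpa using hk)]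
  have hτ_zero : τ ⟨0, hn⟩ = i := by
    have hr0 : r ⟨n - 1, by omega⟩ = ⟨0, hn⟩ := by
      rw [hr]
      refine Fin.ext ?_
      simp [mkFin, Nat.sub_add_cancel hn]
    rw [← hr0, hτr]
    exact hσ_last _ (by simp only; omega)
  have hrot : (fun μ : Fin n → Fin N => g ζ (ξ' ∘ τ) ε (μ ∘ τ)) =
      Dop N i (fun α : Fin N => y (α : ℕ) / y ((α : ℕ) + 1))
        (fun μ => g ζ (ξ ∘ σ) ε (μ ∘ σ)) := by
    funext μ
    have h := hd ζ (ξ ∘ τ) hζ (fun t => hξ _) ε (μ ∘ τ)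
    have hup : Function.update (ξ ∘ τ) ⟨0, hn⟩ (x * ξ i) = ξ' ∘ τ := by
      funext t
      simp only [hξ'_def, Function.update_apply, Function.comp_apply, ← hτ_zero,
        τ.injective.eq_iff]
    simp only [Function.comp_apply, hτ_zero, ← hr, hτr] at h
    rw [hup] at h
    exact h.trans (mul_comm _ _)
  obtain ⟨ρ, hρ_last, hρ_mid, hρ_low, hρ⟩ :=
    hf.exists_move hn hξ' τ ⟨0, hn⟩ i (by simp only; omega)
  have hρ_one : ρ = 1 := by
    ext1 k
    rcases lt_trichotomy (k : ℕ) i with h | h | h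
    · rw [hρ_mid k ⟨k + 1, by omega⟩ (Nat.zero_le _) (by simpa using h) rfl, hτ_succ]
      exact hσ_low _ (Or.inl h)
    · rw [hρ_last k (by simpa using h), hτ_zero]
      exact Fin.ext h.symm
    · rw [hρ_low k (Or.inr (by simpa using h))]
      obtain ⟨_ | l, hl⟩ := k
      · exact absurd h (Nat.not_lt_zero _)
      rw [hτ_succ]
      exact hσ_mid _ _ (by rw [Fin.le_def]; simp only at h ⊢; omega)
        (by simp only at h ⊢; omega) rfl
  have hfin : ∀ s, s < (i : ℕ) → τ (mkFin n hn (0 + 1 + s)) = mkFin n hn s := by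
    intro s hs
    have hsn : s + 1 < n := by omega
    rw [show 0 + 1 + s = s + 1 by omega, mkFin_eq hn hsn, hτ_succ, mkFin_eq hn (by omega)]
    exact hσ_low _ (Or.inl hs)
  have hne : ∀ {k}, k < n → k ≠ i → i ≠ mkFin n hn k := by
    intro k hk hki h
    rw [mkFin_eq hn hk, Fin.ext_iff] at h
    exact hki h.symm
  have htr := ((isTranspose_composeList_map
      (fun t => Rop N q i (mkFin n hn (i + 1 + t)) (ξ i / ξ (mkFin n hn (i + 1 + t))))
      (fun t => RopT N q i (mkFin n hn (i + 1 + t)) (ξ i / ξ (mkFin n hn (i + 1 + t))))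
      (List.range (n - 1 - i)) fun t ht => isTranspose_Rop N q (by
        rw [List.mem_range] at ht
        exact hne (by omega) (by omega)) _).comp
    (isTranspose_Dop N i (fun α : Fin N => y (α : ℕ) / y ((α : ℕ) + 1)))).comp
    (isTranspose_composeList_map
      (fun t => Rop N q i (mkFin n hn t) (x * ξ i / ξ (mkFin n hn t)))
      (fun t => RopT N q i (mkFin n hn t) (x * ξ i / ξ (mkFin n hn t)))
      (List.range i) fun t ht => isTranspose_Rop N q (by
        rw [List.mem_range] at ht
        exact hne (by omega) (by omega)) _)
  rw [composeList_append, composeList_append]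
  refine Eq.trans ?_ (htr.sum_single (g ζ ξ ε) μ).symm
  simp only [Function.comp_apply]
  have hσ' : (fun μ : Fin n → Fin N => g ζ (ξ ∘ σ) ε (μ ∘ σ)) =
      (List.range (n - 1 - i)).foldl (fun F t => RopT N q i (mkFin n hn (i + 1 + t))
        (ξ i / ξ (mkFin n hn (i + 1 + t))) F) (g ζ ξ ε) := hσ
  rw [← hσ', ← hrot]
  have hρ' := congrFun hρ μ
  rw [hρ_one, hτ_zero] at hρ'
  refine Eq.trans hρ' (congrFun (List.foldl_ext _ _ _ fun F s hs => ?_) μ)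
  rw [List.mem_range] at hs
  have hs' : mkFin n hn s ≠ i := (hne (by omega) (by omega)).symm
  simp only [hfin s hs, hξ'_def, Function.update_self, Function.update_of_ne hs']
end

section
/- Fix a content (k_0,…,k_{N−1}) of nonnegative integers with k_0 + ⋯ + k_{N−1} = n. There exist functions b^{L L'}(ξ_1,…,ξ_n) of ξ and q alone (depending on N, n and the ordered partitions L' ≤ L, but not on g, ζ or the upper indices) such that: for every g satisfying, for each 1 ≤ i ≤ n−1 and α ≠ β, the exchange relation g(ζ|…,ξ_{i+1},ξ_i,…)^{ε}_{…,α,β,…} = (ξ_i/ξ_{i+1})^{N−1}( b(ξ_i/ξ_{i+1}) g(ζ|…,ξ_i,ξ_{i+1},…)^{ε}_{…,β,α,…} + c_{βα}(ξ_i/ξ_{i+1}) g(ζ|…,ξ_i,ξ_{i+1},…)^{ε}_{…,α,β,…} ) together with g(ζ|…,ξ_{i+1},ξ_i,…)^{ε}_{…,α,α,…} = (ξ_i/ξ_{i+1})^{N−1} g(ζ|…,ξ_i,ξ_{i+1},…)^{ε}_{…,α,α,…}, and for all ξ with ξ_a^N ≠ ξ_b^N and q²(ξ_a/ξ_b)^N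 ≠ 1 for a ≠ b, one has for every lower index sequence μ of content (k_0,…,k_{N−1}) with associated ordered partition L, and every upper index sequence ε: g(ζ|ξ_1,…,ξ_n)^{ε}_{L} = Σ_{L' ≤ L} b^{L L'}(ξ) · g(ζ|ξ_{L'_0},…,ξ_{L'_{N−1}})^{ε}_{M⁰}, where the diagonal coefficient is b^{L L}(ξ) = ∏_{r>l} ∏_{a∈L_r, b∈L_l, a<b} a_2(ξ_a/ξ_b) with a_2(ζ) = q^{−1} ζ^{1−N} (1 − q²ζ^N)/(1 − ζ^N). -/
open scoped BigOperators

/-- `a_1(ζ) = q⁻¹ ζ^{N-1} (1-q²ζ^N)/(1-ζ^N)`. -/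
noncomputable def a1Fun (N : ℕ) (q ζ : ℂ) : ℂ :=
  q⁻¹ * ζ ^ (N - 1) * (1 - q ^ 2 * ζ ^ N) / (1 - ζ ^ N)

/-- `a_2(ζ) = q⁻¹ ζ^{1-N} (1-q²ζ^N)/(1-ζ^N)`. -/
noncomputable def a2Fun (N : ℕ) (q ζ : ℂ) : ℂ :=
  q⁻¹ * ζ ^ (1 - (N : ℤ)) * (1 - q ^ 2 * ζ ^ N) / (1 - ζ ^ N)

/-- A sequence `ε` has content `(k_0,…,k_{N-1})` iff `#{a : ε a = r} = k r` for all `r`. -/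
def hasContent {m N : ℕ} (ε : Fin m → Fin N) (k : Fin N → ℕ) : Prop :=
  ∀ r : Fin N, (Finset.univ.filter fun a => ε a = r).card = k r

instance {m N : ℕ} (ε : Fin m → Fin N) (k : Fin N → ℕ) : Decidable (hasContent ε k) := by
  unfold hasContent; infer_instance

/-- Lexicographic order on sequences, comparing from the left. -/
def lexLE {m N : ℕ} (a b : Fin m → Fin N) : Prop :=
  a = b ∨ ∃ i : Fin m, (∀ j : Fin m, j < i → a j = b j) ∧ a i < b i

instance {m N : ℕ} (a b : Fin m → Fin N) : Decidable (lexLE a b) := by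
  unfold lexLE; infer_instance

/-- The minimal sequence `ε⁰ = (0^{k_0},1^{k_1},…,(N-1)^{k_{N-1}})` of content `k`:
position `a` belongs to the block determined by the partial sums of `k`. -/
def minSeq (N m : ℕ) (hN : 0 < N) (k : Fin N → ℕ) (a : Fin m) : Fin N :=
  ⟨(Finset.univ.filter fun r : Fin N => (∑ r' ∈ Finset.Iic r, k r') ≤ (a : ℕ)).card % N,
    Nat.mod_lt _ hN⟩

/-- The adjacent transposition exchanging positions `i` and `i + 1`. -/
def adjSwap {n : ℕ} (i : Fin n) (hi : (i : ℕ) + 1 < n) : Equiv.Perm (Fin n) :=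
  Equiv.swap i ⟨(i : ℕ) + 1, hi⟩

section adjSwap

variable {n : ℕ} (i : Fin n) (hi : (i : ℕ) + 1 < n)

lemma adjSwap_left : adjSwap i hi i = ⟨(i : ℕ) + 1, hi⟩ := Equiv.swap_apply_left _ _

lemma adjSwap_right : adjSwap i hi ⟨(i : ℕ) + 1, hi⟩ = i := Equiv.swap_apply_right _ _

lemma adjSwap_adjSwap (t : Fin n) : adjSwap i hi (adjSwap i hi t) = t :=
  Equiv.swap_apply_self _ _ t

lemma comp_adjSwap_adjSwap {α : Type*} (f : Fin n → α) :
    (f ∘ adjSwap i hi) ∘ adjSwap i hi = f := by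
  funext t
  simp [adjSwap_adjSwap]

lemma adjSwap_val (t : Fin n) : (adjSwap i hi t : ℕ) =
    if (t : ℕ) = i then (i : ℕ) + 1 else if (t : ℕ) = (i : ℕ) + 1 then (i : ℕ) else t := by
  unfold adjSwap
  rw [Equiv.swap_apply_def]
  simp only [Fin.ext_iff]
  split_ifs <;> rfl

/-- An adjacent transposition preserves the order of every pair except the one it exchanges. -/
lemma adjSwap_lt_iff {p t : Fin n} (h : ¬(p = i ∧ t = ⟨(i : ℕ) + 1, hi⟩))
    (h' : ¬(p = ⟨(i : ℕ) + 1, hi⟩ ∧ t = i)) :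
    adjSwap i hi p < adjSwap i hi t ↔ p < t := by
  simp only [Fin.ext_iff] at h h'
  rw [Fin.lt_def, Fin.lt_def, adjSwap_val, adjSwap_val]
  split_ifs <;> omega

lemma update_update_eq_comp_adjSwap {α : Type*} (f : Fin n → α) :
    Function.update (Function.update f i (f ⟨(i : ℕ) + 1, hi⟩)) ⟨(i : ℕ) + 1, hi⟩ (f i)
      = f ∘ adjSwap i hi := by
  funext t
  simp only [Function.update_apply, Function.comp_apply, adjSwap, Equiv.swap_apply_def]
  by_cases h : t = i
  · have : i ≠ ⟨(i : ℕ) + 1, hi⟩ := by simp [Fin.ext_iff]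
    rw [h, if_neg this, if_pos rfl, if_pos rfl]
  · rw [if_neg h, if_neg h]
    split_ifs <;> rfl

lemma monotone_of_no_descent {α : Type*} [LinearOrder α] {f : Fin n → α}
    (h : ∀ (i : Fin n) (hi : (i : ℕ) + 1 < n), f i ≤ f ⟨(i : ℕ) + 1, hi⟩) : Monotone f := by
  cases n with
  | zero => exact fun a => a.elim0
  | succ n => exact Fin.monotone_iff_le_succ.2 fun i => h i.castSucc (by simp)

end adjSwap

section content

variable {n N : ℕ} {k : Fin N → ℕ}

lemma hasContent_comp_perm (μ : Fin n → Fin N) (σ : Equiv.Perm (Fin n)) :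
    hasContent (μ ∘ σ) k ↔ hasContent μ k := by
  unfold hasContent
  refine forall_congr' fun r => ?_
  have : (Finset.univ.filter fun a => (μ ∘ σ) a = r).card
      = (Finset.univ.filter fun a => μ a = r).card := by
    simp only [Finset.card_filter, Function.comp_apply]
    exact Equiv.sum_comp σ fun a => if μ a = r then 1 else 0
  rw [this]

lemma sum_Iic_content {μ : Fin n → Fin N} (h : hasContent μ k) (r : Fin N) :
    ∑ r' ∈ Finset.Iic r, k r' = (Finset.univ.filter fun t => μ t ≤ r).card := by
  rw [Finset.card_eq_sum_card_fiberwise (f := μ) (t := Finset.Iic r) (by intro t; simp)]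
  refine Finset.sum_congr rfl fun r' hr' => ?_
  rw [← h r', Finset.filter_filter]
  congr 1
  ext t
  simp only [Finset.mem_filter, Finset.mem_univ, true_and]
  exact ⟨fun e => ⟨e ▸ Finset.mem_Iic.1 hr', e⟩, fun e => e.2⟩

/-- `minSeq` is the only monotone sequence of the given content. -/
lemma minSeq_eq_of_monotone (hN : 0 < N) {μ : Fin n → Fin N} (h : hasContent μ k)
    (hμ : Monotone μ) : minSeq N n hN k = μ := by
  funext a
  have key : ∀ r : Fin N, (∑ r' ∈ Finset.Iic r, k r') ≤ (a : ℕ) ↔ r < μ a := by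
    intro r
    rw [sum_Iic_content h]
    constructor
    · intro hle
      by_contra! hlt
      have hsub : Finset.Iic a ⊆ Finset.univ.filter fun t => μ t ≤ r := by
        intro t ht
        simpa using (hμ (Finset.mem_Iic.1 ht)).trans hlt
      have := Finset.card_le_card hsub
      rw [Fin.card_Iic] at this
      omega
    · intro hlt
      have hsub : (Finset.univ.filter fun t => μ t ≤ r) ⊆ Finset.Iio a := by
        intro t ht
        simp only [Finset.mem_filter, Finset.mem_univ, true_and] at ht
        exact Finset.mem_Iio.2 (hμ.reflect_lt (ht.trans_lt hlt))
      simpa [Fin.card_Iio] using Finset.card_le_card hsub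
  have hcard : (Finset.univ.filter fun r : Fin N =>
      (∑ r' ∈ Finset.Iic r, k r') ≤ (a : ℕ)).card = μ a := by
    simp only [key]
    rw [← Fin.card_Iio (μ a)]
    congr 1
    ext r
    simp
  apply Fin.ext
  simp only [minSeq, hcard]
  exact Nat.mod_eq_of_lt (μ a).isLt

end content

section sort

variable {n : ℕ} {α : Type*} [LinearOrder α] (f : Fin n → α)
  (i : Fin n) (hi : (i : ℕ) + 1 < n)

lemma sort_tie {p t : Fin n} (h : p < t) (e : f (Tuple.sort f p) = f (Tuple.sort f t)) :
    Tuple.sort f p < Tuple.sort f t :=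
  (Tuple.eq_sort_iff.1 (rfl : Tuple.sort f = Tuple.sort f)).2 p t h e

lemma sort_comp_adjSwap (h : f i ≠ f ⟨(i : ℕ) + 1, hi⟩) :
    Tuple.sort (f ∘ adjSwap i hi) = (Tuple.sort f).trans (adjSwap i hi) := by
  symm
  rw [Tuple.eq_sort_iff]
  simp only [Function.comp_def, Equiv.trans_apply, adjSwap_adjSwap]
  refine ⟨Tuple.monotone_sort f, fun p t hpt e => ?_⟩
  rw [adjSwap_lt_iff]
  · exact sort_tie f hpt e
  · rintro ⟨h1, h2⟩
    rw [h1, h2] at e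
    exact h e
  · rintro ⟨h1, h2⟩
    rw [h1, h2] at e
    exact h e.symm

/-- Stability of `Tuple.sort`: equal neighbours stay neighbours after sorting. -/
lemma sort_symm_succ (h : f i = f ⟨(i : ℕ) + 1, hi⟩) :
    (((Tuple.sort f).symm ⟨(i : ℕ) + 1, hi⟩ : Fin n) : ℕ) = ((Tuple.sort f).symm i : ℕ) + 1 := by
  set p := (Tuple.sort f).symm i with hp
  set t := (Tuple.sort f).symm ⟨(i : ℕ) + 1, hi⟩ with ht
  have hp' : Tuple.sort f p = i := by simp [hp]
  have ht' : Tuple.sort f t = ⟨(i : ℕ) + 1, hi⟩ := by simp [ht]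
  have hpt : p < t := by
    by_contra! hle
    rcases hle.eq_or_lt with e | hlt
    · rw [e, hp'] at ht'
      simp [Fin.ext_iff] at ht'
    · have := sort_tie f hlt (by rw [hp', ht', h])
      rw [hp', ht', Fin.lt_def] at this
      simp at this
  by_contra hne
  have hlt : (p : ℕ) + 1 < t := by
    rw [Fin.lt_def] at hpt
    omega
  set u : Fin n := ⟨(p : ℕ) + 1, hlt.trans t.isLt⟩ with hu
  have hpu : p < u := by simp [Fin.lt_def, hu]
  have hut : u < t := by simpa [Fin.lt_def, hu] using hlt
  have h1 : f (Tuple.sort f p) ≤ f (Tuple.sort f u) := Tuple.monotone_sort f hpu.le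
  have h2 : f (Tuple.sort f u) ≤ f (Tuple.sort f t) := Tuple.monotone_sort f hut.le
  have e : f (Tuple.sort f p) = f (Tuple.sort f t) := by rw [hp', ht', h]
  have l1 := sort_tie f hpu (le_antisymm h1 (h2.trans e.ge))
  have l2 := sort_tie f hut (le_antisymm h2 (e.ge.trans h1))
  rw [hp', Fin.lt_def] at l1
  rw [ht', Fin.lt_def] at l2
  simp only at l2
  omega

lemma adjSwap_sort (h : f i = f ⟨(i : ℕ) + 1, hi⟩)
    (hp : ((Tuple.sort f).symm i : ℕ) + 1 < n) (t : Fin n) :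
    adjSwap i hi (Tuple.sort f t)
      = Tuple.sort f (adjSwap ((Tuple.sort f).symm i) hp t) := by
  have e : (⟨((Tuple.sort f).symm i : ℕ) + 1, hp⟩ : Fin n)
      = (Tuple.sort f).symm ⟨(i : ℕ) + 1, hi⟩ := Fin.ext (sort_symm_succ f i hi h).symm
  unfold adjSwap
  rw [e, Equiv.swap_apply_def, Equiv.swap_apply_def]
  simp only [Equiv.eq_symm_apply]
  split_ifs <;> simp

end sort

section bruhat

variable {n N : ℕ}

/-- The number of entries `≥ v` among the first `c` entries of `μ`. -/
def prefixCount (μ : Fin n → Fin N) (c : ℕ) (v : Fin N) : ℕ :=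
  ∑ t : Fin n, if (t : ℕ) < c ∧ v ≤ μ t then 1 else 0

/-- The Bruhat order on sequences, by comparison of prefix counts. -/
def bruhatLE (μ' μ : Fin n → Fin N) : Prop :=
  ∀ (c : ℕ) (v : Fin N), prefixCount μ' c v ≤ prefixCount μ c v

lemma prefixCount_succ (μ : Fin n → Fin N) (i : Fin n) (v : Fin N) :
    prefixCount μ ((i : ℕ) + 1) v = prefixCount μ i v + if v ≤ μ i then 1 else 0 := by
  have e : (if v ≤ μ i then 1 else 0)
      = ∑ t : Fin n, if t = i then if v ≤ μ t then 1 else 0 else 0 := by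
    simp
  unfold prefixCount
  rw [e, ← Finset.sum_add_distrib]
  refine Finset.sum_congr rfl fun t _ => ?_
  simp only [Fin.ext_iff]
  split_ifs <;> omega

lemma prefixCount_comp_adjSwap (μ : Fin n → Fin N) (i : Fin n) (hi : (i : ℕ) + 1 < n) {c : ℕ}
    (hc : c ≠ (i : ℕ) + 1) (v : Fin N) :
    prefixCount (μ ∘ adjSwap i hi) c v = prefixCount μ c v := by
  unfold prefixCount
  rw [← Equiv.sum_comp (adjSwap i hi) fun t : Fin n => if (t : ℕ) < c ∧ v ≤ μ t then 1 else 0]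
  refine Finset.sum_congr rfl fun t _ => ?_
  have : (adjSwap i hi t : ℕ) < c ↔ (t : ℕ) < c := by
    rw [adjSwap_val]
    split_ifs <;> omega
  simp only [Function.comp_apply, this]

lemma prefixCount_comp_adjSwap_succ (μ : Fin n → Fin N) (i : Fin n) (hi : (i : ℕ) + 1 < n)
    (v : Fin N) :
    prefixCount (μ ∘ adjSwap i hi) ((i : ℕ) + 1) v
      = prefixCount μ i v + if v ≤ μ ⟨(i : ℕ) + 1, hi⟩ then 1 else 0 := by
  rw [prefixCount_succ, prefixCount_comp_adjSwap μ i hi (by omega), Function.comp_apply,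
    adjSwap_left]

lemma prefixCount_succ_succ (μ : Fin n → Fin N) (i : Fin n) (hi : (i : ℕ) + 1 < n) (v : Fin N) :
    prefixCount μ ((i : ℕ) + 1 + 1) v = prefixCount μ i v + (if v ≤ μ i then 1 else 0)
      + if v ≤ μ ⟨(i : ℕ) + 1, hi⟩ then 1 else 0 := by
  rw [← prefixCount_succ, ← prefixCount_succ μ ⟨(i : ℕ) + 1, hi⟩]

lemma bruhatLE_refl (μ : Fin n → Fin N) : bruhatLE μ μ := fun _ _ => le_rfl

lemma bruhatLE.lexLE {μ' μ : Fin n → Fin N} (h : bruhatLE μ' μ) : lexLE μ' μ := by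
  by_cases he : μ' = μ
  · exact Or.inl he
  right
  have hex : (Finset.univ.filter fun t => μ' t ≠ μ t).Nonempty := by
    obtain ⟨t, ht⟩ := Function.ne_iff.1 he
    exact ⟨t, by simpa using ht⟩
  set i := (Finset.univ.filter fun t => μ' t ≠ μ t).min' hex with hidef
  have hi : μ' i ≠ μ i := (Finset.mem_filter.1 (Finset.min'_mem _ hex)).2
  have hlt : ∀ j, j < i → μ' j = μ j := by
    intro j hj
    by_contra hne
    exact (Finset.min'_le _ j (by simpa using hne)).not_gt hj
  refine ⟨i, hlt, lt_of_le_of_ne ?_ hi⟩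
  by_contra! hgt
  have hc : prefixCount μ' i (μ' i) = prefixCount μ i (μ' i) := by
    refine Finset.sum_congr rfl fun t _ => ?_
    by_cases ht : (t : ℕ) < i
    · rw [hlt t (Fin.lt_def.2 ht)]
    · simp [ht]
  have := h ((i : ℕ) + 1) (μ' i)
  rw [prefixCount_succ, prefixCount_succ, hc, if_pos le_rfl, if_neg hgt.not_ge] at this
  omega

variable {μ' μ : Fin n → Fin N} {i : Fin n} {hi : (i : ℕ) + 1 < n}

lemma bruhatLE.of_comp_adjSwap (hd : μ ⟨(i : ℕ) + 1, hi⟩ < μ i)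
    (h : bruhatLE μ' (μ ∘ adjSwap i hi)) : bruhatLE μ' μ := by
  intro c v
  by_cases hc : c = (i : ℕ) + 1
  · subst hc
    refine (h _ v).trans ?_
    rw [prefixCount_comp_adjSwap_succ, prefixCount_succ]
    have : v ≤ μ ⟨(i : ℕ) + 1, hi⟩ → v ≤ μ i := fun hv => hv.trans hd.le
    split_ifs <;> simp_all
  · rw [← prefixCount_comp_adjSwap μ i hi hc]
    exact h c v

/-- The lifting property of the Bruhat order. -/
lemma bruhatLE.comp_adjSwap (hd : μ ⟨(i : ℕ) + 1, hi⟩ < μ i)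
    (h : bruhatLE μ' (μ ∘ adjSwap i hi)) : bruhatLE (μ' ∘ adjSwap i hi) μ := by
  intro c v
  by_cases hc : c = (i : ℕ) + 1
  · subst hc
    have h0 := h i v
    have h2 := h ((i : ℕ) + 1 + 1) v
    rw [prefixCount_comp_adjSwap μ i hi (by omega)] at h0 h2
    rw [prefixCount_succ_succ μ' i hi, prefixCount_succ_succ μ i hi] at h2
    rw [prefixCount_comp_adjSwap_succ, prefixCount_succ]
    have : v ≤ μ ⟨(i : ℕ) + 1, hi⟩ → v ≤ μ i := fun hv => hv.trans hd.le
    split_ifs at h2 ⊢ <;> omega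
  · rw [prefixCount_comp_adjSwap μ' i hi hc, ← prefixCount_comp_adjSwap μ i hi hc]
    exact h c v

lemma not_bruhatLE_comp_adjSwap (hd : μ ⟨(i : ℕ) + 1, hi⟩ < μ i) :
    ¬bruhatLE μ (μ ∘ adjSwap i hi) := by
  intro h
  have := h ((i : ℕ) + 1) (μ i)
  rw [prefixCount_comp_adjSwap_succ, prefixCount_succ, if_pos le_rfl, if_neg hd.not_ge] at this
  omega

end bruhat

section expansion

variable {m n N : ℕ} {q : ℂ}

/-- The diagonal coefficient: the product of `a_2(ξ_p/ξ_s)` over the inversions `(p, s)` of `μ`. -/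
noncomputable def inversionProd (q : ℂ) (μ : Fin n → Fin N) (ξ : Fin n → ℂ) : ℂ :=
  ∏ p : Fin n, ∏ s : Fin n, if p < s ∧ μ s < μ p then a2Fun N q (ξ p / ξ s) else 1

lemma inversionProd_of_monotone {μ : Fin n → Fin N} (hμ : Monotone μ) (ξ : Fin n → ℂ) :
    inversionProd q μ ξ = 1 := by
  refine Finset.prod_eq_one fun p _ => Finset.prod_eq_one fun s _ => if_neg ?_
  rintro ⟨h1, h2⟩
  exact (hμ h1.le).not_gt h2

lemma inversionProd_of_descent {μ : Fin n → Fin N} {i : Fin n} {hi : (i : ℕ) + 1 < n}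
    (hd : μ ⟨(i : ℕ) + 1, hi⟩ < μ i) (ξ : Fin n → ℂ) :
    inversionProd q μ ξ = a2Fun N q (ξ i / ξ ⟨(i : ℕ) + 1, hi⟩)
      * inversionProd q (μ ∘ adjSwap i hi) (ξ ∘ adjSwap i hi) := by
  set j : Fin n := ⟨(i : ℕ) + 1, hi⟩ with hj
  have hij : i < j := by simp [Fin.lt_def, hj]
  have e : inversionProd q (μ ∘ adjSwap i hi) (ξ ∘ adjSwap i hi)
      = ∏ p : Fin n, ∏ s : Fin n, if adjSwap i hi p < adjSwap i hi s ∧ μ s < μ p then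
          a2Fun N q (ξ p / ξ s) else 1 := by
    unfold inversionProd
    rw [← Equiv.prod_comp (adjSwap i hi)]
    refine Finset.prod_congr rfl fun p _ => ?_
    rw [← Equiv.prod_comp (adjSwap i hi)]
    simp only [Function.comp_apply, adjSwap_adjSwap]
  have e' : a2Fun N q (ξ i / ξ j) = ∏ p : Fin n, ∏ s : Fin n,
      if p = i then if s = j then a2Fun N q (ξ p / ξ s) else 1 else 1 := by
    simp [Finset.prod_ite_eq']
  rw [e, e', ← Finset.prod_mul_distrib]
  refine Finset.prod_congr rfl fun p _ => ?_
  rw [← Finset.prod_mul_distrib]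
  refine Finset.prod_congr rfl fun s _ => ?_
  by_cases h : p = i ∧ s = j
  · rw [h.1, h.2, hj, adjSwap_left, adjSwap_right, ← hj, if_pos ⟨hij, hd⟩, if_pos rfl,
      if_pos rfl, if_neg fun h => hij.not_gt h.1, mul_one]
  · have h1 : (if p = i then if s = j then a2Fun N q (ξ p / ξ s) else 1 else 1) = 1 := by
      split_ifs <;> simp_all
    rw [h1, one_mul]
    by_cases hji : p = j ∧ s = i
    · obtain ⟨rfl, rfl⟩ := hji
      simp [hd.not_gt]
    · simp only [adjSwap_lt_iff i hi h hji]

/-- The exchange relations in the lower indices. -/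
def LowerExchange (q : ℂ)
    (g : (Fin m → ℂ) → (Fin n → ℂ) → (Fin m → Fin N) → (Fin n → Fin N) → ℂ) : Prop :=
  ∀ (ζ : Fin m → ℂ) (ξ : Fin n → ℂ), (∀ t, ζ t ≠ 0) → (∀ t, ξ t ≠ 0) →
    ∀ (i : Fin n) (hi : (i : ℕ) + 1 < n) (ε : Fin m → Fin N) (μ : Fin n → Fin N)
      (α β : Fin N),
      (α ≠ β →
        g ζ (fun t => ξ (Equiv.swap i ⟨(i : ℕ) + 1, hi⟩ t)) ε
            (Function.update (Function.update μ i α) ⟨(i : ℕ) + 1, hi⟩ β)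
          = (ξ i / ξ ⟨(i : ℕ) + 1, hi⟩) ^ (N - 1)
            * (bFun N q (ξ i / ξ ⟨(i : ℕ) + 1, hi⟩)
                  * g ζ ξ ε (Function.update (Function.update μ i β)
                      ⟨(i : ℕ) + 1, hi⟩ α)
                + cFun N q β α (ξ i / ξ ⟨(i : ℕ) + 1, hi⟩)
                  * g ζ ξ ε (Function.update (Function.update μ i α)
                      ⟨(i : ℕ) + 1, hi⟩ β)))
      ∧ g ζ (fun t => ξ (Equiv.swap i ⟨(i : ℕ) + 1, hi⟩ t)) ε
            (Function.update (Function.update μ i α) ⟨(i : ℕ) + 1, hi⟩ α)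
          = (ξ i / ξ ⟨(i : ℕ) + 1, hi⟩) ^ (N - 1)
            * g ζ ξ ε (Function.update (Function.update μ i α)
                ⟨(i : ℕ) + 1, hi⟩ α)

/-- The component of `g` at the extremal lower index, with spectral parameters sorted by `μ`. -/
def extremalComponent (hN : 0 < N) (k : Fin N → ℕ)
    (g : (Fin m → ℂ) → (Fin n → ℂ) → (Fin m → Fin N) → (Fin n → Fin N) → ℂ)
    (ζ : Fin m → ℂ) (ε : Fin m → Fin N) (μ : Fin n → Fin N) (ξ : Fin n → ℂ) : ℂ :=
  g ζ (fun t => ξ (Tuple.sort μ t)) ε (minSeq N n hN k)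

/-- The factor produced by exchanging two neighbouring spectral parameters in an extremal
component. -/
noncomputable def tieFactor (μ : Fin n → Fin N) (i : Fin n) (hi : (i : ℕ) + 1 < n)
    (ξ : Fin n → ℂ) : ℂ :=
  if μ i = μ ⟨(i : ℕ) + 1, hi⟩ then (ξ i / ξ ⟨(i : ℕ) + 1, hi⟩) ^ (N - 1) else 1

lemma tieFactor_comp_adjSwap (μ : Fin n → Fin N) (i : Fin n) (hi : (i : ℕ) + 1 < n)
    (ξ : Fin n → ℂ) : tieFactor (μ ∘ adjSwap i hi) i hi ξ = tieFactor μ i hi ξ := by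
  simp only [tieFactor, Function.comp_apply, adjSwap_left, adjSwap_right, eq_comm]

variable {k : Fin N → ℕ} {hN : 0 < N}
  {g : (Fin m → ℂ) → (Fin n → ℂ) → (Fin m → Fin N) → (Fin n → Fin N) → ℂ}

lemma LowerExchange.extremalComponent_comp_adjSwap (hg : LowerExchange q g)
    {ζ : Fin m → ℂ} {ξ : Fin n → ℂ} (hζ : ∀ t, ζ t ≠ 0) (hξ : ∀ t, ξ t ≠ 0)
    (ε : Fin m → Fin N) {μ : Fin n → Fin N} (hμ : hasContent μ k)
    (i : Fin n) (hi : (i : ℕ) + 1 < n) :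
    extremalComponent hN k g ζ ε μ (ξ ∘ adjSwap i hi)
      = tieFactor μ i hi ξ * extremalComponent hN k g ζ ε (μ ∘ adjSwap i hi) ξ := by
  unfold extremalComponent tieFactor
  by_cases h : μ i = μ ⟨(i : ℕ) + 1, hi⟩
  · rw [if_pos h]
    have hs := sort_symm_succ μ i hi h
    set p := (Tuple.sort μ).symm i with hpdef
    have hp : (p : ℕ) + 1 < n := by
      rw [← hs]
      exact Fin.isLt _
    have hps : Tuple.sort μ p = i := by simp [hpdef]
    have hps' : Tuple.sort μ ⟨(p : ℕ) + 1, hp⟩ = ⟨(i : ℕ) + 1, hi⟩ := by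
      have : (⟨(p : ℕ) + 1, hp⟩ : Fin n) = (Tuple.sort μ).symm ⟨(i : ℕ) + 1, hi⟩ := Fin.ext hs.symm
      rw [this, Equiv.apply_symm_apply]
    have hmin : minSeq N n hN k = μ ∘ Tuple.sort μ :=
      minSeq_eq_of_monotone hN ((hasContent_comp_perm μ _).2 hμ) (Tuple.monotone_sort μ)
    have hmineq : minSeq N n hN k ⟨(p : ℕ) + 1, hp⟩ = minSeq N n hN k p := by
      rw [hmin, Function.comp_apply, Function.comp_apply, hps, hps', h]
    have hswap : μ ∘ adjSwap i hi = μ := by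
      rw [← update_update_eq_comp_adjSwap, ← h, Function.update_eq_self, h,
        Function.update_eq_self]
    have hrel := (hg ζ (fun t => ξ (Tuple.sort μ t)) hζ (fun t => hξ _) p hp ε
      (minSeq N n hN k) (minSeq N n hN k p) (minSeq N n hN k p)).2
    simp only [hps, hps'] at hrel
    rw [Function.update_eq_self, ← hmineq, Function.update_eq_self] at hrel
    rw [hswap, ← hrel]
    congr 1
    funext t
    exact congrArg ξ (adjSwap_sort μ i hi h hp t)
  · rw [if_neg h, one_mul, sort_comp_adjSwap μ i hi h]
    rfl

lemma LowerExchange.descent_step (hq : q ≠ 0) (hg : LowerExchange q g)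
    {ζ : Fin m → ℂ} {ξ : Fin n → ℂ} (hζ : ∀ t, ζ t ≠ 0) (hξ : ∀ t, ξ t ≠ 0)
    (hne : ∀ p s : Fin n, p ≠ s → ξ p ^ N ≠ ξ s ^ N)
    (hne' : ∀ p s : Fin n, p ≠ s → q ^ 2 * (ξ p / ξ s) ^ N ≠ 1)
    (ε : Fin m → Fin N) {μ : Fin n → Fin N} {i : Fin n} {hi : (i : ℕ) + 1 < n}
    (hd : μ ⟨(i : ℕ) + 1, hi⟩ < μ i) :
    g ζ ξ ε μ = a2Fun N q (ξ i / ξ ⟨(i : ℕ) + 1, hi⟩)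
        * g ζ (ξ ∘ adjSwap i hi) ε (μ ∘ adjSwap i hi)
      - cFun N q (μ i) (μ ⟨(i : ℕ) + 1, hi⟩) (ξ i / ξ ⟨(i : ℕ) + 1, hi⟩)
          / bFun N q (ξ i / ξ ⟨(i : ℕ) + 1, hi⟩) * g ζ ξ ε (μ ∘ adjSwap i hi) := by
  have hrel := (hg ζ ξ hζ hξ i hi ε μ (μ ⟨(i : ℕ) + 1, hi⟩) (μ i)).1 hd.ne
  rw [update_update_eq_comp_adjSwap, Function.update_eq_self, Function.update_eq_self] at hrel
  have hij : i ≠ ⟨(i : ℕ) + 1, hi⟩ := by simp [Fin.ext_iff]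
  have h1 := hne _ _ hij
  have h2 := hne' _ _ hij
  have h3 := hξ i
  have h4 := hξ ⟨(i : ℕ) + 1, hi⟩
  set r := ξ i / ξ ⟨(i : ℕ) + 1, hi⟩ with hr
  have hr0 : r ≠ 0 := div_ne_zero h3 h4
  have hrN : 1 - r ^ N ≠ 0 := by
    rw [sub_ne_zero, hr, div_pow, ne_comm, Ne, div_eq_one_iff_eq (pow_ne_zero _ h4)]
    exact h1
  have hrq : 1 - q ^ 2 * r ^ N ≠ 0 := sub_ne_zero.2 h2.symm
  have hb : bFun N q r ≠ 0 := div_ne_zero (mul_ne_zero hq hrN) hrq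
  have hpow : r ^ (1 - (N : ℤ)) = (r ^ (N - 1))⁻¹ := by
    obtain ⟨M, rfl⟩ := Nat.exists_eq_succ_of_ne_zero (μ i).pos.ne'
    rw [← zpow_natCast, ← zpow_neg]
    congr 1
    simp
  have ha : a2Fun N q r = (r ^ (N - 1))⁻¹ / bFun N q r := by
    unfold a2Fun bFun
    rw [hpow]
    field_simp
  have hrel' : g ζ (ξ ∘ adjSwap i hi) ε (μ ∘ adjSwap i hi) = r ^ (N - 1)
      * (bFun N q r * g ζ ξ ε μ
        + cFun N q (μ i) (μ ⟨(i : ℕ) + 1, hi⟩) r * g ζ ξ ε (μ ∘ adjSwap i hi)) := hrel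
  rw [ha, hrel']
  have hrp : r ^ (N - 1) ≠ 0 := pow_ne_zero _ hr0
  field_simp
  ring

/-- Expansion in extremal components with Bruhat-triangular coefficients. -/
lemma exists_bruhat_expansion (m : ℕ) (hN : 0 < N) (hq : q ≠ 0) (k : Fin N → ℕ)
    (μ : Fin n → Fin N) (hμ : hasContent μ k) :
    ∃ B : (Fin n → Fin N) → (Fin n → ℂ) → ℂ,
      (∀ μ' ξ, ¬bruhatLE μ' μ → B μ' ξ = 0) ∧ (∀ ξ, B μ ξ = inversionProd q μ ξ) ∧
      ∀ g : (Fin m → ℂ) → (Fin n → ℂ) → (Fin m → Fin N) → (Fin n → Fin N) → ℂ,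
        LowerExchange q g → ∀ (ζ : Fin m → ℂ) (ξ : Fin n → ℂ), (∀ t, ζ t ≠ 0) → (∀ t, ξ t ≠ 0) →
          (∀ p s : Fin n, p ≠ s → ξ p ^ N ≠ ξ s ^ N) →
          (∀ p s : Fin n, p ≠ s → q ^ 2 * (ξ p / ξ s) ^ N ≠ 1) → ∀ ε : Fin m → Fin N,
            g ζ ξ ε μ = ∑ μ' : Fin n → Fin N,
              if hasContent μ' k then B μ' ξ * extremalComponent hN k g ζ ε μ' ξ else 0 := by
  induction hx : toLex μ using WellFoundedLT.induction generalizing μ with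
  | ind x ih =>
  subst hx
  by_cases hmono : Monotone μ
  · refine ⟨fun μ' _ => if μ' = μ then 1 else 0, fun μ' ξ h => if_neg ?_, fun ξ => ?_, ?_⟩
    · rintro rfl
      exact h (bruhatLE_refl _)
    · rw [inversionProd_of_monotone hmono]
      exact if_pos rfl
    · intro g _ ζ ξ _ _ _ _ ε
      rw [Finset.sum_eq_single μ (by intro μ' _ h; simp [h]) (by simp), if_pos hμ]
      simp only [if_pos, one_mul]
      rw [extremalComponent, minSeq_eq_of_monotone hN hμ hmono,
        Tuple.sort_eq_refl_iff_monotone.2 hmono]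
      rfl
  · obtain ⟨i, hi, hd⟩ : ∃ (i : Fin n) (hi : (i : ℕ) + 1 < n), μ ⟨(i : ℕ) + 1, hi⟩ < μ i := by
      by_contra! h
      exact hmono (monotone_of_no_descent h)
    have hlt : toLex (μ ∘ adjSwap i hi) < toLex μ := by
      refine ⟨i, fun t ht => ?_, ?_⟩
      · have : adjSwap i hi t = t := by
          apply Fin.ext
          have ht : (t : ℕ) < i := ht
          rw [adjSwap_val, if_neg (by omega), if_neg (by omega)]
        exact congrArg μ this
      · change μ (adjSwap i hi i) < μ i
        rwa [adjSwap_left]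
    obtain ⟨B, hB, hdiag, hexp⟩ := ih _ hlt (μ ∘ adjSwap i hi)
      ((hasContent_comp_perm μ _).2 hμ) rfl
    set j : Fin n := ⟨(i : ℕ) + 1, hi⟩ with hj
    refine ⟨fun μ' ξ => a2Fun N q (ξ i / ξ j) * (tieFactor μ' i hi ξ
        * B (μ' ∘ adjSwap i hi) (ξ ∘ adjSwap i hi))
      - cFun N q (μ i) (μ j) (ξ i / ξ j) / bFun N q (ξ i / ξ j) * B μ' ξ,
      fun μ' ξ h => ?_, fun ξ => ?_, ?_⟩
    · have h1 : ¬bruhatLE (μ' ∘ adjSwap i hi) (μ ∘ adjSwap i hi) := fun h' =>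
        h (comp_adjSwap_adjSwap i hi μ' ▸ h'.comp_adjSwap hd)
      have h2 : ¬bruhatLE μ' (μ ∘ adjSwap i hi) := fun h' => h (h'.of_comp_adjSwap hd)
      simp only [hB _ _ h1, hB _ _ h2, mul_zero, sub_zero]
    · have : tieFactor μ i hi ξ = 1 := if_neg hd.ne'
      simp only [hB _ _ (not_bruhatLE_comp_adjSwap hd), hdiag, this, one_mul, mul_zero, sub_zero]
      rw [inversionProd_of_descent hd]
    · intro g hg ζ ξ hζ hξ hne hne' ε
      have hinj := (adjSwap i hi).injective
      rw [hg.descent_step hq hζ hξ hne hne' ε hd,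
        hexp g hg ζ ξ hζ hξ hne hne' ε,
        hexp g hg ζ (ξ ∘ adjSwap i hi) hζ (fun t => hξ _)
          (fun p s h => hne _ _ (hinj.ne h)) (fun p s h => hne' _ _ (hinj.ne h)) ε,
        ← Equiv.sum_comp ((adjSwap i hi).arrowCongr (Equiv.refl (Fin N)))]
      rw [Finset.mul_sum, Finset.mul_sum, ← Finset.sum_sub_distrib]
      refine Finset.sum_congr rfl fun μ' _ => ?_
      have harr : (adjSwap i hi).arrowCongr (Equiv.refl (Fin N)) μ' = μ' ∘ adjSwap i hi := rfl
      rw [harr]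
      simp only [hasContent_comp_perm]
      split_ifs with hc
      · rw [hg.extremalComponent_comp_adjSwap hζ hξ ε ((hasContent_comp_perm μ' _).2 hc) i hi,
          comp_adjSwap_adjSwap, tieFactor_comp_adjSwap]
        ring
      · simp

end expansion

/-- triangular expansion of the lower components of `Ḡ`-type functions
in terms of the extremal component, with explicit diagonal coefficients
`b^{LL} = ∏_{r>l} ∏_{a∈L_r,b∈L_l,a<b} a_2(ξ_a/ξ_b)`. -/
theorem triangular_expansion_lower (N : ℕ) (hN : 2 ≤ N) (q : ℂ) (hq : q ≠ 0)
    (m n : ℕ) (k : Fin N → ℕ) (hk : ∑ r : Fin N, k r = n) :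
    ∃ b : (Fin n → Fin N) → (Fin n → Fin N) → (Fin n → ℂ) → ℂ,
      (∀ μ : Fin n → Fin N, hasContent μ k → ∀ ξ : Fin n → ℂ,
        b μ μ ξ = ∏ p : Fin n, ∏ s : Fin n,
          if p < s ∧ μ s < μ p then a2Fun N q (ξ p / ξ s) else 1)
      ∧ ∀ g : (Fin m → ℂ) → (Fin n → ℂ) → (Fin m → Fin N) → (Fin n → Fin N) → ℂ,
          (∀ (ζ : Fin m → ℂ) (ξ : Fin n → ℂ), (∀ t, ζ t ≠ 0) → (∀ t, ξ t ≠ 0) →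
            ∀ (i : Fin n) (hi : (i : ℕ) + 1 < n) (ε : Fin m → Fin N) (μ : Fin n → Fin N)
              (α β : Fin N),
              (α ≠ β →
                g ζ (fun t => ξ (Equiv.swap i ⟨(i : ℕ) + 1, hi⟩ t)) ε
                    (Function.update (Function.update μ i α) ⟨(i : ℕ) + 1, hi⟩ β)
                  = (ξ i / ξ ⟨(i : ℕ) + 1, hi⟩) ^ (N - 1)
                    * (bFun N q (ξ i / ξ ⟨(i : ℕ) + 1, hi⟩)
                          * g ζ ξ ε (Function.update (Function.update μ i β)
                              ⟨(i : ℕ) + 1, hi⟩ α)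
                        + cFun N q β α (ξ i / ξ ⟨(i : ℕ) + 1, hi⟩)
                          * g ζ ξ ε (Function.update (Function.update μ i α)
                              ⟨(i : ℕ) + 1, hi⟩ β)))
              ∧ g ζ (fun t => ξ (Equiv.swap i ⟨(i : ℕ) + 1, hi⟩ t)) ε
                    (Function.update (Function.update μ i α) ⟨(i : ℕ) + 1, hi⟩ α)
                  = (ξ i / ξ ⟨(i : ℕ) + 1, hi⟩) ^ (N - 1)
                    * g ζ ξ ε (Function.update (Function.update μ i α)
                        ⟨(i : ℕ) + 1, hi⟩ α)) →
          ∀ (ζ : Fin m → ℂ) (ξ : Fin n → ℂ), (∀ t, ζ t ≠ 0) → (∀ t, ξ t ≠ 0) →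
            (∀ p s : Fin n, p ≠ s → ξ p ^ N ≠ ξ s ^ N) →
            (∀ p s : Fin n, p ≠ s → q ^ 2 * (ξ p / ξ s) ^ N ≠ 1) →
            ∀ μ : Fin n → Fin N, hasContent μ k → ∀ ε : Fin m → Fin N,
              g ζ ξ ε μ
                = ∑ μ' : Fin n → Fin N,
                    if hasContent μ' k ∧ lexLE μ' μ then
                      b μ μ' ξ
                        * g ζ (fun t => ξ (Tuple.sort μ' t)) ε
                            (minSeq N n (by omega) k)
                    else 0 := by
  choose B hB hdiag hexp using exists_bruhat_expansion m (by omega : 0 < N) hq k (n := n)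
  refine ⟨fun μ μ' ξ => if hμ : hasContent μ k then B μ hμ μ' ξ else 0, ?_, ?_⟩
  · intro μ hμ ξ
    simp only [dif_pos hμ]
    exact hdiag μ hμ ξ
  · intro g hg ζ ξ hζ hξ hne hne' μ hμ ε
    rw [hexp μ hμ g hg ζ ξ hζ hξ hne hne' ε]
    refine Finset.sum_congr rfl fun μ' _ => ?_
    simp only [dif_pos hμ]
    by_cases hc : hasContent μ' k
    · by_cases hl : lexLE μ' μ
      · rw [if_pos hc, if_pos ⟨hc, hl⟩]
        rfl
      · rw [if_pos hc, if_neg fun h => hl h.2, hB μ hμ μ' ξ fun h => hl h.lexLE, zero_mul]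
    · rw [if_neg hc, if_neg fun h => hc h.1]
end
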